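/- If a and c are odd natural numbers and b is an even natural number, then Player 1 has a winning strategy in the (a,b,c)-game; that is, the state with a ones, b twos, and c threes is a first-player win in the reversed Zeckendorf game. -/

import Mathlib

/-- The Fibonacci numbers indexed so that `zfib 1 = 1`, `zfib 2 = 2`,
and `zfib (i+1) = zfib i + zfib (i-1)`. -/
def zfib (i : ℕ) : ℕ := Nat.fib (i + 1)

/-- A game state: a finitely supported function recording the height of each bin.
Bin indices start at `1`; index `0` is unused. -/
abbrev ZState := ℕ →₀ ℕ

/-- The legal moves of the reversed Zeckendorf game. -/
inductive ZMove : ZState → ZState → Prop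
  | split (h : ZState) (i : ℕ) (hi : 2 ≤ i) (hpos : 0 < h (i + 1)) :
      ZMove h (h - Finsupp.single (i + 1) 1 + Finsupp.single i 1 + Finsupp.single (i - 1) 1)
  | splitTwo (h : ZState) (hpos : 0 < h 2) :
      ZMove h (h - Finsupp.single 2 1 + Finsupp.single 1 2)
  | combine (h : ZState) (i : ℕ) (hi : 2 < i) (h1 : 0 < h (i + 1)) (h2 : 0 < h (i - 2)) :
      ZMove h (h - Finsupp.single (i + 1) 1 - Finsupp.single (i - 2) 1 + Finsupp.single i 2)
  | combineTwo (h : ZState) (h1 : 0 < h 3) (h2 : 0 < h 1) :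
      ZMove h (h - Finsupp.single 3 1 - Finsupp.single 1 1 + Finsupp.single 2 2)

mutual
  /-- The state is a first-player win: some legal move leads to a state that is a
  loss for the player then to move. -/
  inductive ZFirstWin : ZState → Prop
    | intro (h h' : ZState) (m : ZMove h h') (hl : ZLoss h') : ZFirstWin h
  /-- The state is a loss for the player to move (i.e., not a first-player win):
  every legal move leads to a first-player win for the opponent. -/
  inductive ZLoss : ZState → Prop
    | intro (h : ZState) (hall : ∀ h', ZMove h h' → ZFirstWin h') : ZLoss h
end

/-- The starting state of the `(a,b,c)`-game: `a` ones, `b` twos and `c` threes. -/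
noncomputable def abcState (a b c : ℕ) : ZState :=
  Finsupp.single 1 a + Finsupp.single 2 b + Finsupp.single 3 c

theorem abc_ge4 (a b c i : ℕ) (hi : 4 ≤ i) : abcState a b c i = 0 := by
  simp only [abcState, Finsupp.add_apply, Finsupp.single_apply]
  split_ifs <;> omega

theorem abc_eq1 (a b c : ℕ) :
    abcState a b (c+1) - Finsupp.single 3 1 + Finsupp.single 2 1 + Finsupp.single 1 1
      = abcState (a+1) (b+1) c := by
  ext j
  simp only [abcState, Finsupp.add_apply, Finsupp.tsub_apply, Finsupp.single_apply]
  split_ifs <;> omega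

theorem abc_eq2 (a b c : ℕ) :
    abcState a (b+1) c - Finsupp.single 2 1 + Finsupp.single 1 2 = abcState (a+2) b c := by
  ext j
  simp only [abcState, Finsupp.add_apply, Finsupp.tsub_apply, Finsupp.single_apply]
  split_ifs <;> omega

theorem abc_eq3 (a b c : ℕ) :
    abcState (a+1) b (c+1) - Finsupp.single 3 1 - Finsupp.single 1 1 + Finsupp.single 2 2
      = abcState a (b+2) c := by
  ext j
  simp only [abcState, Finsupp.add_apply, Finsupp.tsub_apply, Finsupp.single_apply]
  split_ifs <;> omega

theorem abc_m1 (a b c : ℕ) : ZMove (abcState a b (c+1)) (abcState (a+1) (b+1) c) := by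
  rw [← abc_eq1]
  exact ZMove.split _ 2 le_rfl (by simp [abcState])

theorem abc_m2 (a b c : ℕ) : ZMove (abcState a (b+1) c) (abcState (a+2) b c) := by
  rw [← abc_eq2]
  exact ZMove.splitTwo _ (by simp [abcState])

theorem abc_m3 (a b c : ℕ) : ZMove (abcState (a+1) b (c+1)) (abcState a (b+2) c) := by
  rw [← abc_eq3]
  exact ZMove.combineTwo _ (by simp [abcState]) (by simp [abcState])

theorem abc_moves (a b c : ℕ) (s h' : ZState) (hs : s = abcState a b c) (m : ZMove s h') :
    (∃ c', c = c' + 1 ∧ h' = abcState (a+1) (b+1) c') ∨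
    (∃ b', b = b' + 1 ∧ h' = abcState (a+2) b' c) ∨
    (∃ a' c', a = a' + 1 ∧ c = c' + 1 ∧ h' = abcState a' (b+2) c') := by
  cases m with
  | split i hi hpos =>
    subst hs
    have : i = 2 := by
      by_contra hne
      rw [abc_ge4 _ _ _ _ (by omega)] at hpos
      omega
    subst this
    left
    have hc : 0 < c := by simpa [abcState] using hpos
    obtain ⟨c', rfl⟩ : ∃ c', c = c' + 1 := ⟨c - 1, by omega⟩
    exact ⟨c', rfl, abc_eq1 a b c'⟩
  | splitTwo hpos =>
    subst hs
    right; left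
    have hc : 0 < b := by simpa [abcState] using hpos
    obtain ⟨b', rfl⟩ : ∃ c', b = c' + 1 := ⟨b - 1, by omega⟩
    exact ⟨b', rfl, abc_eq2 a b' c⟩
  | combine i hi h1 h2 =>
    subst hs
    rw [abc_ge4 _ _ _ _ (by omega)] at h1
    omega
  | combineTwo h1 h2 =>
    subst hs
    right; right
    have hc : 0 < c := by simpa [abcState] using h1
    have ha : 0 < a := by simpa [abcState] using h2
    obtain ⟨c', rfl⟩ : ∃ c', c = c' + 1 := ⟨c - 1, by omega⟩
    obtain ⟨a', rfl⟩ : ∃ c', a = c' + 1 := ⟨a - 1, by omega⟩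
    exact ⟨a', c', rfl, rfl, abc_eq3 a' b c'⟩

/-- The losing positions. -/
def abcLosing (a b c : ℕ) : Prop :=
  b % 2 = 0 ∧ ((c % 2 = 1 ∧ a % 2 = 0 ∧ a < c) ∨ (c % 2 = 0 ∧ (a % 2 = 0 ∨ c < a)))

theorem abc_main (n : ℕ) : ∀ a b c : ℕ, 3 * c + b = n →
    (abcLosing a b c → ZLoss (abcState a b c)) ∧
    (¬ abcLosing a b c → ZFirstWin (abcState a b c)) := by
  induction n using Nat.strong_induction_on with
  | _ n ih =>
  intro a b c hn
  constructor
  · intro hP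
    refine ZLoss.intro _ fun h' m => ?_
    rcases abc_moves a b c _ h' rfl m with ⟨c', rfl, rfl⟩ | ⟨b', rfl, rfl⟩ | ⟨a', c', rfl, rfl, rfl⟩
    all_goals
      refine (ih _ ?_ _ _ _ rfl).2 ?_
      · omega
      · unfold abcLosing at *
        omega
  · intro hP
    have key : (∃ c', c = c' + 1 ∧ abcLosing (a+1) (b+1) c') ∨
        (∃ b', b = b' + 1 ∧ abcLosing (a+2) b' c) ∨
        (∃ a' c', a = a' + 1 ∧ c = c' + 1 ∧ abcLosing a' (b+2) c') := by
      unfold abcLosing at *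
      by_cases h1 : 0 < c ∧ ((b+1) % 2 = 0 ∧ (((c-1) % 2 = 1 ∧ (a+1) % 2 = 0 ∧ (a+1) < (c-1)) ∨
          ((c-1) % 2 = 0 ∧ ((a+1) % 2 = 0 ∨ (c-1) < a+1))))
      · exact Or.inl ⟨c - 1, by omega, h1.2⟩
      by_cases h2 : b % 2 = 1
      · exact Or.inr (Or.inl ⟨b - 1, by omega, by omega⟩)
      · exact Or.inr (Or.inr ⟨a - 1, c - 1, by omega, by omega, by omega⟩)
    rcases key with ⟨c', rfl, hl⟩ | ⟨b', rfl, hl⟩ | ⟨a', c', rfl, rfl, hl⟩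
    · exact ZFirstWin.intro _ _ (abc_m1 _ _ _) ((ih _ (by omega) _ _ _ rfl).1 hl)
    · exact ZFirstWin.intro _ _ (abc_m2 _ _ _) ((ih _ (by omega) _ _ _ rfl).1 hl)
    · exact ZFirstWin.intro _ _ (abc_m3 _ _ _) ((ih _ (by omega) _ _ _ rfl).1 hl)

theorem abcGame_odd_even_odd_firstPlayerWin (a b c : ℕ) (ha : Odd a) (hb : Even b) (hc : Odd c) :
    ZFirstWin (abcState a b c) := by
  refine (abc_main _ a b c rfl).2 ?_
  rw [Nat.odd_iff] at ha hc
  unfold abcLosing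
  omega
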